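/- Let n be a square-free natural number and p a prime dividing n. The number of isomorphism classes of finite groups of order n whose commutator subgroup is cyclic of order exactly p equals 2^{c̄_n(p)} − 1, where c̄_n(p) is the number of primes q dividing n such that q divides p−1. -/

import Mathlib

/-- The multiplication underlying a group structure `s` on a type `α`. -/
def groupMul {α : Type*} (s : Group α) : Mul α := by letI := s; infer_instance

/-- The setoid identifying isomorphic group structures (satisfying a predicate `P`)
on the carrier `Fin n`; its quotient is the set of isomorphism classes of groups of
order `n` satisfying `P`. -/
def isoSetoid {n : ℕ} (P : Group (Fin n) → Prop) : Setoid {s : Group (Fin n) // P s} where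
  r s t := Nonempty (@MulEquiv (Fin n) (Fin n) (groupMul s.1) (groupMul t.1))
  iseqv := by
    refine ⟨fun s => ⟨@MulEquiv.refl _ (groupMul s.1)⟩, ?_, ?_⟩
    · rintro s t ⟨e⟩
      exact ⟨@MulEquiv.symm _ _ (groupMul s.1) (groupMul t.1) e⟩
    · rintro s t u ⟨e⟩ ⟨f⟩
      exact ⟨@MulEquiv.trans _ _ _ (groupMul s.1) (groupMul t.1) (groupMul u.1) e f⟩

open SemidirectProduct

theorem Nat.card_divisors_of_squarefree {n : ℕ} (hn : Squarefree n) :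
    n.divisors.card = 2 ^ n.primeFactors.card := by
  rw [Nat.card_divisors hn.ne_zero, ← Finset.prod_const]
  refine Finset.prod_congr rfl fun q hq => ?_
  have h1 := hn.natFactorization_le_one q
  have h2 := (Nat.prime_of_mem_primeFactors hq).factorization_pos_of_dvd hn.ne_zero
    (Nat.dvd_of_mem_primeFactors hq)
  omega

theorem IsCyclic.zpowers_eq_of_orderOf_eq {A : Type*} [Group A] [Finite A] [IsCyclic A] {a b : A}
    (h : orderOf a = orderOf b) : Subgroup.zpowers a = Subgroup.zpowers b := by
  classical
  have := Fintype.ofFinite A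
  have key : ∀ x : A, orderOf x = orderOf a →
      (Subgroup.zpowers x : Set A) = ↑({y : A | y ^ orderOf a = 1} : Finset A) := by
    intro x hx
    refine Set.eq_of_subset_of_ncard_le ?_ ?_
    · rintro _ ⟨k, rfl⟩
      simp only [Finset.coe_filter, Finset.mem_univ, true_and, Set.mem_ofPred_eq, ← hx]
      rw [← zpow_natCast, zpow_comm, zpow_natCast, pow_orderOf_eq_one, one_zpow]
    · rw [Set.ncard_coe_finset, ← Nat.card_coe_set_eq]
      refine (IsCyclic.card_pow_eq_one_le (orderOf_pos a)).trans_eq ?_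
      rw [← hx]
      exact (Nat.card_zpowers x).symm
  exact SetLike.coe_injective ((key a rfl).trans (key b h.symm).symm)

theorem IsCyclic.exists_coprime_pow_eq {A : Type*} [Group A] [Finite A] [IsCyclic A] {a b : A}
    (h : orderOf a = orderOf b) {m : ℕ} [NeZero m] (hm : orderOf b ∣ m) :
    ∃ k : ℕ, m.Coprime k ∧ b ^ k = a := by
  have ha : a ∈ Subgroup.zpowers b :=
    zpowers_eq_of_orderOf_eq h ▸ Subgroup.mem_zpowers a
  obtain ⟨k, rfl⟩ := mem_powers_iff_mem_zpowers.mpr ha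
  simp only at h
  rw [orderOf_pow, Nat.div_eq_self] at h
  have hk : Nat.Coprime k (orderOf b) :=
    Nat.coprime_comm.mp (h.resolve_left (orderOf_pos b).ne')
  obtain ⟨u, hu⟩ := ZMod.unitsMap_surjective hm (ZMod.unitOfCoprime k hk)
  refine ⟨(u : ZMod m).val, (ZMod.val_coe_unit_coprime u).symm, ?_⟩
  rw [pow_eq_pow_iff_modEq, ← ZMod.natCast_eq_natCast_iff]
  have := congrArg Units.val hu
  rw [ZMod.unitsMap_val, ZMod.coe_unitOfCoprime] at this
  rw [← this, ZMod.natCast_val]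

theorem orderOf_map_of_forall_mem_zpowers {H A : Type*} [Group H] [Group A] (φ : H →* A) {h : H}
    (hh : ∀ x, x ∈ Subgroup.zpowers h) : orderOf (φ h) = Nat.card φ.range := by
  rw [← Nat.card_zpowers, ← MonoidHom.map_zpowers, (Subgroup.eq_top_iff' _).mpr hh,
    MonoidHom.range_eq_map]

theorem IsCyclic.exists_comp_eq_of_card_range_eq {H A : Type*} [Group H] [Finite H] [IsCyclic H]
    [Group A] [Finite A] [IsCyclic A] {φ ψ : H →* A}
    (h : Nat.card φ.range = Nat.card ψ.range) : ∃ f : H ≃* H, φ = ψ.comp f.toMonoidHom := by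
  obtain ⟨g, hg⟩ := IsCyclic.exists_generator (α := H)
  have hgo := orderOf_eq_card_of_forall_mem_zpowers hg
  have : NeZero (Nat.card H) := ⟨Nat.card_pos.ne'⟩
  obtain ⟨k, hk, hka⟩ := IsCyclic.exists_coprime_pow_eq (a := φ g) (b := ψ g) (m := Nat.card H)
    (by simpa only [orderOf_map_of_forall_mem_zpowers _ hg] using h)
    (hgo ▸ orderOf_map_dvd ψ g)
  have hgk : ∀ x, x ∈ Subgroup.zpowers (g ^ k) := by
    have : orderOf (g ^ k) = Nat.card H := by
      rw [Nat.Coprime.orderOf_pow (hgo ▸ hk), hgo]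
    rw [← Subgroup.eq_top_iff']
    exact Subgroup.eq_top_of_card_eq _ (by rw [Nat.card_zpowers, this])
  refine ⟨mulEquivOfOrderOfEq hg hgk (hgo.trans (orderOf_eq_card_of_forall_mem_zpowers hgk).symm),
    (MonoidHom.eq_iff_eq_on_generator hg _ _).mpr ?_⟩
  simp [← hka]

namespace SemidirectProduct

theorem nonempty_mulEquiv_of_card_range_eq {N H : Type*} [Group N] [Finite N] [Group H] [Finite H]
    [IsCyclic H] [IsCyclic (MulAut N)] {φ ψ : H →* MulAut N}
    (h : Nat.card φ.range = Nat.card ψ.range) : Nonempty (N ⋊[φ] H ≃* N ⋊[ψ] H) := by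
  obtain ⟨f, hf⟩ := IsCyclic.exists_comp_eq_of_card_range_eq h
  exact ⟨congr (MulEquiv.refl N) f fun g => by ext; simp [hf]⟩

theorem centralizer_range_inl {N H : Type*} [CommGroup N] [Group H] (φ : H →* MulAut N) :
    Subgroup.centralizer ((inl : N →* N ⋊[φ] H).range : Set (N ⋊[φ] H)) =
      (φ.comp rightHom).ker := by
  ext g
  simp only [Subgroup.mem_centralizer_iff, SetLike.mem_coe, MonoidHom.mem_range,
    forall_exists_index, forall_apply_eq_imp_iff, MonoidHom.mem_ker, MonoidHom.comp_apply,
    MulEquiv.ext_iff, MulAut.one_apply]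
  refine forall_congr' fun x => ?_
  simp only [SemidirectProduct.ext_iff, mul_left, mul_right, left_inl, right_inl, map_one,
    MulAut.one_apply, one_mul, mul_one, and_true, rightHom_eq_right]
  rw [mul_comm, mul_right_inj, eq_comm]

theorem index_centralizer_range_inl {N H : Type*} [CommGroup N] [Group H] (φ : H →* MulAut N) :
    (Subgroup.centralizer ((inl : N →* N ⋊[φ] H).range : Set (N ⋊[φ] H))).index =
      Nat.card φ.range := by
  rw [centralizer_range_inl, Subgroup.index_ker, MonoidHom.range_comp,
    MonoidHom.range_eq_top.mpr rightHom_surjective, ← MonoidHom.range_eq_map]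

theorem commutator_le_range_inl {N H : Type*} [Group N] [CommGroup H] (φ : H →* MulAut N) :
    commutator (N ⋊[φ] H) ≤ (inl : N →* N ⋊[φ] H).range := by
  rw [range_inl_eq_ker_rightHom]
  exact Abelianization.commutator_subset_ker _

theorem card_range_inl {N H : Type*} [Group N] [Group H] (φ : H →* MulAut N) :
    Nat.card (inl : N →* N ⋊[φ] H).range = Nat.card N :=
  Nat.card_congr (MonoidHom.ofInjective inl_injective).toEquiv.symm

theorem commutator_eq_range_inl_of_card_eq {N H : Type*} [Group N] [Finite N] [CommGroup H]
    {φ : H →* MulAut N} (h : Nat.card (commutator (N ⋊[φ] H)) = Nat.card N) :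
    commutator (N ⋊[φ] H) = (inl : N →* N ⋊[φ] H).range := by
  have : Finite (inl : N →* N ⋊[φ] H).range := Set.finite_range _
  exact Subgroup.eq_of_le_of_card_ge (commutator_le_range_inl φ) (by rw [h, card_range_inl])

theorem card_commutator_eq_of_prime {N H : Type*} [CommGroup N] [CommGroup H]
    (hN : (Nat.card N).Prime) {φ : H →* MulAut N} :
    Nat.card (commutator (N ⋊[φ] H)) = Nat.card N ↔ Nat.card φ.range ≠ 1 := by
  have : Finite N := Nat.finite_of_card_ne_zero hN.ne_zero
  refine ⟨fun h h1 => ?_, fun h => ?_⟩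
  · have hφ : ∀ g, φ g = 1 := fun g =>
      Subgroup.mem_bot.mp (Subgroup.card_eq_one.mp h1 ▸ MonoidHom.mem_range.mpr ⟨g, rfl⟩)
    have hbot : commutator (N ⋊[φ] H) = ⊥ := (commutator_eq_bot_iff _).mpr
      ⟨⟨fun a b => by ext <;> simp [hφ, mul_comm]⟩⟩
    rw [hbot, Subgroup.card_bot] at h
    exact hN.one_lt.ne h
  · have hdvd : Nat.card (commutator (N ⋊[φ] H)) ∣ Nat.card N :=
      card_range_inl φ ▸ Subgroup.card_dvd_of_le (commutator_le_range_inl φ)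
    refine (hN.eq_one_or_self_of_dvd _ hdvd).resolve_left fun h1 => h ?_
    have hcomm := (commutator_eq_bot_iff _).mp (Subgroup.card_eq_one.mp h1)
    rw [← index_centralizer_range_inl, Subgroup.index_eq_one, Subgroup.eq_top_iff']
    exact fun x => Subgroup.mem_centralizer_iff.mpr fun y _ => hcomm.is_comm.comm y x

end SemidirectProduct

theorem IsCyclic.exists_card_range_eq {H A : Type*} [Group H] [IsCyclic H] [Group A] [Finite A]
    [IsCyclic A] {d : ℕ} (hH : d ∣ Nat.card H) (hA : d ∣ Nat.card A) :
    ∃ φ : H →* A, Nat.card φ.range = d := by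
  obtain ⟨g, hg⟩ := IsCyclic.exists_generator (α := H)
  obtain ⟨a, ha⟩ := IsCyclic.exists_ofOrder_eq_natCard (α := A)
  have ho : orderOf (a ^ (orderOf a / d)) = d :=
    orderOf_pow_orderOf_div (orderOf_pos a).ne' (ha ▸ hA)
  refine ⟨monoidHomOfForallMemZpowers hg (g' := a ^ (orderOf a / d)) ?_, ?_⟩
  · rwa [ho, orderOf_eq_card_of_forall_mem_zpowers hg]
  · rw [← orderOf_map_of_forall_mem_zpowers _ hg, monoidHomOfForallMemZpowers_apply_gen, ho]

theorem IsCyclic.isCyclic_mulAut_of_prime_card {N : Type*} [Group N] (hN : (Nat.card N).Prime) :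
    IsCyclic (MulAut N) := by
  have := Fact.mk hN
  have hc : IsCyclic N := isCyclic_of_prime_card rfl
  exact (IsCyclic.mulAutMulEquiv N).isCyclic.mpr (ZMod.isCyclic_units_prime hN)

theorem exists_mulEquiv_semidirectProduct {p m : ℕ} (hpm : Squarefree (p * m)) (hp : p.Prime)
    {G : Type*} [Group G] (hG : Nat.card G = p * m) (hG' : Nat.card (commutator G) = p) :
    ∃ φ : Multiplicative (ZMod m) →* MulAut (Multiplicative (ZMod p)),
      Nonempty (G ≃* Multiplicative (ZMod p) ⋊[φ] Multiplicative (ZMod m)) := by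
  have := Fact.mk hp
  have : Finite G := Nat.finite_of_card_ne_zero (hG ▸ hpm.ne_zero)
  have hindex : (commutator G).index = m := by
    have := (commutator G).card_mul_index
    rw [hG, hG'] at this
    exact Nat.eq_of_mul_eq_mul_left hp.pos this
  obtain ⟨K, hK⟩ := Subgroup.exists_right_complement'_of_coprime (N := commutator G)
    (by rw [hG', hindex]; exact (Nat.squarefree_mul_iff.mp hpm).1)
  have : IsZGroup G := IsZGroup.of_squarefree (hG ▸ hpm)
  have : IsCyclic K := (hK.symm.QuotientMulEquiv).isCyclic.mp
    (inferInstanceAs (IsCyclic (Abelianization G)))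
  have hKcard : Nat.card K = Nat.card (Multiplicative (ZMod m)) := by
    rw [← hK.symm.index_eq_card, hindex]
    exact (Nat.card_zmod m).symm
  exact ⟨_, ⟨(mulEquivSubgroup hK).symm.trans
    (congr' (mulEquivOfPrimeCardEq hG'
      (show Nat.card (Multiplicative (ZMod p)) = p from Nat.card_zmod p))
      (mulEquivOfCyclicCardEq hKcard))⟩⟩

/-- The order of the group of automorphisms induced by `G` on its commutator subgroup. -/
noncomputable def centralizerCommutatorIndex (G : Type*) [Group G] : ℕ :=
  (Subgroup.centralizer (commutator G : Set G)).index

theorem MulEquiv.map_commutator {G G' : Type*} [Group G] [Group G'] (e : G ≃* G') :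
    (commutator G).map e.toMonoidHom = commutator G' := by
  rw [map_commutator_eq, MonoidHom.range_eq_top.mpr e.surjective, commutator_def]

theorem MulEquiv.card_commutator_eq {G G' : Type*} [Group G] [Group G'] (e : G ≃* G') :
    Nat.card (commutator G) = Nat.card (commutator G') := by
  rw [← e.map_commutator]
  exact (Subgroup.card_map_of_injective e.injective).symm

theorem MulEquiv.centralizerCommutatorIndex_eq {G G' : Type*} [Group G] [Group G'] (e : G ≃* G') :
    centralizerCommutatorIndex G = centralizerCommutatorIndex G' := by
  unfold centralizerCommutatorIndex
  rw [← Subgroup.index_comap_of_surjective _ (f := e.toMonoidHom) e.surjective]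
  congr 1
  ext g
  simp only [Subgroup.mem_comap, Subgroup.mem_centralizer_iff, ← e.map_commutator,
    SetLike.mem_coe, Subgroup.mem_map, forall_exists_index, and_imp, forall_apply_eq_imp_iff₂]
  refine forall₂_congr fun x _ => ?_
  simp [← map_mul]

theorem SemidirectProduct.centralizerCommutatorIndex_eq {N H : Type*} [CommGroup N] [Finite N]
    [CommGroup H] {φ : H →* MulAut N} (h : Nat.card (commutator (N ⋊[φ] H)) = Nat.card N) :
    centralizerCommutatorIndex (N ⋊[φ] H) = Nat.card φ.range := by
  rw [centralizerCommutatorIndex, commutator_eq_range_inl_of_card_eq h,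
    index_centralizer_range_inl]

theorem nonempty_mulEquiv_of_centralizerCommutatorIndex_eq {p m : ℕ}
    (hpm : Squarefree (p * m)) (hp : p.Prime) {G G' : Type*} [Group G] [Group G']
    (hG : Nat.card G = p * m)
    (hGc : Nat.card (commutator G) = p) (hG' : Nat.card G' = p * m)
    (hGc' : Nat.card (commutator G') = p)
    (h : centralizerCommutatorIndex G = centralizerCommutatorIndex G') :
    Nonempty (G ≃* G') := by
  have := Fact.mk hp
  have : NeZero m := ⟨right_ne_zero_of_mul hpm.ne_zero⟩
  obtain ⟨φ, ⟨e⟩⟩ := exists_mulEquiv_semidirectProduct hpm hp hG hGc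
  obtain ⟨ψ, ⟨f⟩⟩ := exists_mulEquiv_semidirectProduct hpm hp hG' hGc'
  have hN : Nat.card (Multiplicative (ZMod p)) = p := Nat.card_zmod p
  have : IsCyclic (MulAut (Multiplicative (ZMod p))) :=
    IsCyclic.isCyclic_mulAut_of_prime_card (hN.symm ▸ hp)
  rw [e.card_commutator_eq] at hGc
  rw [f.card_commutator_eq] at hGc'
  rw [e.centralizerCommutatorIndex_eq, f.centralizerCommutatorIndex_eq,
    SemidirectProduct.centralizerCommutatorIndex_eq (hGc.trans hN.symm),
    SemidirectProduct.centralizerCommutatorIndex_eq (hGc'.trans hN.symm)] at h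
  obtain ⟨k⟩ := nonempty_mulEquiv_of_card_range_eq h
  exact ⟨(e.trans k).trans f.symm⟩

theorem centralizerCommutatorIndex_mem {p m : ℕ} (hpm : Squarefree (p * m)) (hp : p.Prime)
    {G : Type*} [Group G] (hG : Nat.card G = p * m)
    (hGc : Nat.card (commutator G) = p) :
    centralizerCommutatorIndex G ∈ ((p * m).gcd (p - 1)).divisors.erase 1 := by
  have := Fact.mk hp
  obtain ⟨φ, ⟨e⟩⟩ := exists_mulEquiv_semidirectProduct hpm hp hG hGc
  have hN : Nat.card (Multiplicative (ZMod p)) = p := Nat.card_zmod p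
  have hH : Nat.card (Multiplicative (ZMod m)) = m := Nat.card_zmod m
  rw [e.card_commutator_eq] at hGc
  replace hGc := hGc.trans hN.symm
  rw [e.centralizerCommutatorIndex_eq, SemidirectProduct.centralizerCommutatorIndex_eq hGc,
    Finset.mem_erase, Nat.mem_divisors, Nat.dvd_gcd_iff]
  refine ⟨(card_commutator_eq_of_prime (hN.symm ▸ hp)).mp hGc, ⟨?_, ?_⟩,
    Nat.gcd_ne_zero_left hpm.ne_zero⟩
  · exact ((Subgroup.card_range_dvd φ).trans hH.dvd).trans (dvd_mul_left m p)
  · have h := Subgroup.card_subgroup_dvd_card φ.range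
    rwa [IsCyclic.card_mulAut, hN, Nat.totient_prime hp] at h

theorem exists_centralizerCommutatorIndex_eq {p m : ℕ} (hp : p.Prime) {d : ℕ}
    (hd : d ∈ ((p * m).gcd (p - 1)).divisors.erase 1) :
    ∃ (G : Type) (_ : Group G), Nat.card G = p * m ∧ Nat.card (commutator G) = p ∧
      centralizerCommutatorIndex G = d := by
  have := Fact.mk hp
  rw [Finset.mem_erase, Nat.mem_divisors, Nat.dvd_gcd_iff] at hd
  obtain ⟨hd1, ⟨hdn, hdp⟩, -⟩ := hd
  have hN : Nat.card (Multiplicative (ZMod p)) = p := Nat.card_zmod p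
  have hH : Nat.card (Multiplicative (ZMod m)) = m := Nat.card_zmod m
  have : IsCyclic (MulAut (Multiplicative (ZMod p))) :=
    IsCyclic.isCyclic_mulAut_of_prime_card (hN.symm ▸ hp)
  have hcop : Nat.Coprime d p :=
    ((Nat.coprime_self_sub_left hp.one_le).mpr (Nat.coprime_one_left p)).coprime_dvd_left hdp
  obtain ⟨φ, hφ⟩ := IsCyclic.exists_card_range_eq (H := Multiplicative (ZMod m))
    (A := MulAut (Multiplicative (ZMod p))) (d := d) (hH.symm ▸ hcop.dvd_of_dvd_mul_left hdn)
    (by rwa [IsCyclic.card_mulAut, hN, Nat.totient_prime hp])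
  have hc : Nat.card (commutator (Multiplicative (ZMod p) ⋊[φ] Multiplicative (ZMod m))) =
      Nat.card (Multiplicative (ZMod p)) :=
    (card_commutator_eq_of_prime (hN.symm ▸ hp)).mpr (hφ ▸ hd1)
  exact ⟨_, inferInstance, by rw [SemidirectProduct.card, hN, hH], hc.trans hN,
    (SemidirectProduct.centralizerCommutatorIndex_eq hc).trans hφ⟩

theorem Equiv.exists_group_mulEquiv {α G : Type*} [Group G] (e : α ≃ G) :
    ∃ _ : Group α, Nonempty (α ≃* G) :=
  ⟨e.group, ⟨e.mulEquiv⟩⟩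

theorem Nat.card_divisors_gcd_erase_one {n k : ℕ} (hn : Squarefree n) (hk : k ≠ 0) :
    ((n.gcd k).divisors.erase 1).card = 2 ^ (n.primeFactors.filter (· ∣ k)).card - 1 := by
  rw [Finset.card_erase_of_mem (Nat.one_mem_divisors.mpr (Nat.gcd_ne_zero_left hn.ne_zero)),
    Nat.card_divisors_of_squarefree (hn.squarefree_of_dvd (Nat.gcd_dvd_left n k)),
    Nat.primeFactors_gcd hn.ne_zero hk]
  congr 3
  ext q
  simp only [Finset.mem_inter, Finset.mem_filter, Nat.mem_primeFactors]
  tauto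

/-- Let `n` be a square-free natural number and `p` a prime dividing `n`.  The number
of isomorphism classes of groups of order `n` whose commutator subgroup is cyclic of
order exactly `p` equals `2 ^ c̄_n(p) - 1`, where `c̄_n(p)` is the number of primes
`q` dividing `n` with `q ∣ p - 1`. -/
theorem stmt_11 {n : ℕ} (hn : Squarefree n) {p : ℕ} (hp : p.Prime) (hpn : p ∣ n) :
    Nat.card (Quotient (isoSetoid (fun s : Group (Fin n) =>
      letI := s
      IsCyclic ↥(commutator (Fin n)) ∧ Nat.card ↥(commutator (Fin n)) = p))) =
    2 ^ (n.primeFactors.filter (fun q => q ∣ p - 1)).card - 1 := by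
  obtain ⟨m, rfl⟩ := hpn
  rw [← Nat.card_divisors_gcd_erase_one hn (Nat.sub_pos_of_lt hp.one_lt).ne',
    ← Fintype.card_coe, ← Nat.card_eq_fintype_card]
  refine Nat.card_congr (Equiv.ofBijective (Quotient.lift (fun s =>
    ⟨@centralizerCommutatorIndex (Fin (p * m)) s.1, ?_⟩) ?_) ⟨?_, ?_⟩)
  · exact @centralizerCommutatorIndex_mem p m hn hp _ s.1 (Nat.card_fin _) s.2.2
  · rintro s t ⟨e⟩
    exact Subtype.ext (@MulEquiv.centralizerCommutatorIndex_eq _ _ s.1 t.1 e)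
  · rintro ⟨s⟩ ⟨t⟩ h
    exact Quotient.sound (@nonempty_mulEquiv_of_centralizerCommutatorIndex_eq p m hn hp _ _ s.1 t.1
      (Nat.card_fin _) s.2.2 (Nat.card_fin _) t.2.2 (congrArg Subtype.val h))
  · rintro ⟨d, hd⟩
    obtain ⟨G, _, hG, hGc, hGd⟩ := exists_centralizerCommutatorIndex_eq hp hd
    have : Finite G := Nat.finite_of_card_ne_zero (hG ▸ hn.ne_zero)
    let e : Fin (p * m) ≃ G := (Finite.equivFinOfCardEq hG).symm
    obtain ⟨s, ⟨f⟩⟩ := e.exists_group_mulEquiv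
    have := Fact.mk hp
    have hc := f.card_commutator_eq.trans hGc
    exact ⟨⟦⟨s, isCyclic_of_prime_card hc, hc⟩⟧,
      Subtype.ext (f.centralizerCommutatorIndex_eq.trans hGd)⟩
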